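/- arXiv:0903.2009 — 2 statements merged into one kernel-verified Lean document; each statement's English description precedes it below -/
import Mathlib

section
/- Let ν, b, μ, k, ξ₀ be real with ν ≠ 0, b² = 144 μ ν / 47 and ν k² = μ/47, and set A = −1800 μ³/(47³ ν). Define τ(ξ) = (k/2) tanh( k(ξ−ξ₀)/2 ) and u(ξ) = 120ν τ³ − 15b τ² + (60μ/19 − 30ν k² − 15b²/(76ν)) τ + (5/2) b k² − 13 b³/(608 ν²) + 7 μ b/(76 ν). Then u satisfies the KS travelling-wave ODE ν u''' + b u'' + μ u' + u²/2 + A = 0 for all real ξ. -/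
/-- The profile `(k/2) tanh(k(ξ-ξ₀)/2)` solves the Riccati equation `τ' = k²/4 - τ²`. -/
theorem hasDerivAt_half_mul_tanh (k ξ₀ ξ : ℝ) :
    HasDerivAt (fun x : ℝ => k / 2 * Real.tanh (k * (x - ξ₀) / 2))
      (k ^ 2 / 4 - (k / 2 * Real.tanh (k * (ξ - ξ₀) / 2)) ^ 2) ξ := by
  have hc := (Real.cosh_pos (k * (ξ - ξ₀) / 2)).ne'
  have hlin : HasDerivAt (fun x : ℝ => k * (x - ξ₀) / 2) (k / 2) ξ := by
    simpa using (((hasDerivAt_id ξ).sub_const ξ₀).const_mul k).div_const 2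
  have h := (hlin.sinh.div hlin.cosh hc).const_mul (k / 2)
  simp only [Real.tanh_eq_sinh_div_cosh]
  refine h.congr_deriv ?_
  field_simp
  ring

/-- The chain rule for a polynomial evaluated along a solution of `τ' = k²/4 - τ²`. -/
theorem deriv_eval_of_riccati {τ : ℝ → ℝ} {k : ℝ}
    (hτ : ∀ ξ, HasDerivAt τ (k ^ 2 / 4 - τ ξ ^ 2) ξ) (p : Polynomial ℝ) :
    deriv (fun ξ => p.eval (τ ξ)) =
      fun ξ => (p.derivative * (Polynomial.C (k ^ 2 / 4) - Polynomial.X ^ 2)).eval (τ ξ) := by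
  funext ξ
  simpa [Function.comp_def] using ((p.hasDerivAt (τ ξ)).comp ξ (hτ ξ)).deriv

/-- Kudryashov's trigonometric solution of KS with b²/(μν) = 144/47. The third-degree polynomial in
`τ(ξ) = (k/2) tanh(k(ξ-ξ₀)/2)` satisfies the Kuramoto–Sivashinsky
travelling-wave ODE `ν u''' + b u'' + μ u' + u²/2 + A = 0` for all real ξ. -/
theorem ks_trig_solution_3 (ν b μ A k ξ₀ : ℝ) (hν : ν ≠ 0)
    (hb : b ^ 2 = 144 * μ * ν / 47) (hk : ν * k ^ 2 = μ / 47)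
    (hA : A = -1800 * μ ^ 3 / (47 ^ 3 * ν))
    (τ : ℝ → ℝ) (hτ : ∀ ξ : ℝ, τ ξ = k / 2 * Real.tanh (k * (ξ - ξ₀) / 2))
    (u : ℝ → ℝ)
    (hu : ∀ ξ : ℝ, u ξ = 120 * ν * (τ ξ) ^ 3 - 15 * b * (τ ξ) ^ 2
      + (60 * μ / 19 - 30 * ν * k ^ 2 - 15 * b ^ 2 / (76 * ν)) * τ ξ
      + 5 / 2 * b * k ^ 2 - 13 * b ^ 3 / (608 * ν ^ 2)
      + 7 * μ * b / (76 * ν)) :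
    ∀ ξ : ℝ,
      ν * deriv (deriv (deriv u)) ξ + b * deriv (deriv u) ξ
      + μ * deriv u ξ + (u ξ) ^ 2 / 2 + A = 0 := by
  intro ξ
  obtain ⟨κ, rfl⟩ : ∃ κ, b = 12 * ν * κ := ⟨b / (12 * ν), by field_simp⟩
  obtain rfl : μ = 47 * ν * k ^ 2 := by linarith
  have hκ : k ^ 2 = κ ^ 2 := by
    have h : (144 * ν ^ 2) * k ^ 2 = (144 * ν ^ 2) * κ ^ 2 := by linarith
    exact mul_left_cancel₀ (by positivity) h
  have hτ' (x : ℝ) : HasDerivAt τ (κ ^ 2 / 4 - τ x ^ 2) x := by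
    rw [funext hτ, ← hκ]
    exact hasDerivAt_half_mul_tanh k ξ₀ x
  let p : Polynomial ℝ := .C (120 * ν) * .X ^ 3 - .C (180 * ν * κ) * .X ^ 2
    + .C (90 * ν * κ ^ 2) * .X + .C (45 * ν * κ ^ 3)
  have hup : u = fun x => p.eval (τ x) := by
    funext x
    simp only [hu, hκ, p, Polynomial.eval_add, Polynomial.eval_sub, Polynomial.eval_mul,
      Polynomial.eval_pow, Polynomial.eval_C, Polynomial.eval_X]
    field_simp
    ring
  have hA' : A = -1800 * ν ^ 2 * κ ^ 6 := by
    rw [hA, hκ]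
    field_simp
  simp only [hup, deriv_eval_of_riccati hτ', hA', hκ]
  simp [p, -map_pow]
  ring
end

section
/- For every real ξ₀ and every real ξ, the function u(ξ) = tanh(ξ−ξ₀) / (2 + tanh²(ξ−ξ₀)) satisfies the first-order second-degree ODE 2 u'² + (24 u² − 3) u' + 72 u⁴ − 17 u² + 1 = 0. -/
theorem Real.hasDerivAt_tanh_one_sub_sq (x : ℝ) :
    HasDerivAt Real.tanh (1 - Real.tanh x ^ 2) x := by
  have hc : Real.cosh x ≠ 0 := (Real.cosh_pos x).ne'
  have h := (Real.hasDerivAt_sinh x).div (Real.hasDerivAt_cosh x) hc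
  rw [show Real.tanh = Real.sinh / Real.cosh from funext Real.tanh_eq_sinh_div_cosh]
  refine h.congr_deriv ?_
  rw [Pi.div_apply]
  field_simp

/-- The function `u(ξ) = tanh(ξ-ξ₀)/(2 + tanh²(ξ-ξ₀))` satisfies the
first-order second-degree ODE `2u'² + (24u² - 3)u' + 72u⁴ - 17u² + 1 = 0`
for every real `ξ`. -/
theorem rational_tanh_subequation (ξ₀ : ℝ) (u : ℝ → ℝ)
    (hu : ∀ ξ : ℝ, u ξ = Real.tanh (ξ - ξ₀) / (2 + Real.tanh (ξ - ξ₀) ^ 2)) :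
    ∀ ξ : ℝ,
      2 * (deriv u ξ) ^ 2 + (24 * (u ξ) ^ 2 - 3) * deriv u ξ
      + 72 * (u ξ) ^ 4 - 17 * (u ξ) ^ 2 + 1 = 0 := by
  intro ξ
  have ht : HasDerivAt (fun x => Real.tanh (x - ξ₀)) (1 - Real.tanh (ξ - ξ₀) ^ 2) ξ :=
    (Real.hasDerivAt_tanh_one_sub_sq (ξ - ξ₀)).comp_sub_const ξ ξ₀
  have hD : 2 + Real.tanh (ξ - ξ₀) ^ 2 ≠ 0 := by positivity
  have hd := ((ht.fun_div ((ht.fun_pow 2).const_add 2) hD).congr_of_eventuallyEq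
    (.of_forall hu)).deriv
  rw [hd, hu]
  field_simp
  ring
end
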